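/- Let (Ω,F,P) be a non-atomic probability space, G ⊆ F a sub-σ-algebra, u1, u2 ∈ U⁺_icx and X ∈ L∞(F). If 0 < α1 ≤ α2 < 1, then the conditional generalized quantiles satisfy ρ_{α1}^G(X) ≤ ρ_{α2}^G(X) P-a.s. -/

import Mathlib

open MeasureTheory Set Filter Topology

variable {Ω : Type*}

/-- `Z ∈ L∞(𝒢)`: `Z` is `𝒢`-measurable and bounded. -/
def BddMeas (𝒢 : MeasurableSpace Ω) (Z : Ω → ℝ) : Prop :=
  Measurable[𝒢] Z ∧ ∃ C : ℝ, ∀ ω, |Z ω| ≤ C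

/-- `u ∈ U⁺_icx`: `u` is strictly increasing and convex on `[0,∞)` with `u 0 = 0`, `u 1 = 1`. -/
def Uicx (u : ℝ → ℝ) : Prop :=
  StrictMonoOn u (Set.Ici 0) ∧ ConvexOn ℝ (Set.Ici 0) u ∧ u 0 = 0 ∧ u 1 = 1

/-- `π_α(X,Z) = α·E[u1((X−Z)⁺)] + (1−α)·E[u2((X−Z)⁻)]`. -/
noncomputable def piRisk {mΩ : MeasurableSpace Ω} (P : Measure Ω) (u1 u2 : ℝ → ℝ) (α : ℝ)
    (X Z : Ω → ℝ) : ℝ :=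
  α * ∫ ω, u1 (max (X ω - Z ω) 0) ∂P + (1 - α) * ∫ ω, u2 (max (Z ω - X ω) 0) ∂P

/-- The set of minimizers of `Z ↦ π_α(X,Z)` over `L∞(𝒢)`. -/
def ArgminSet {mΩ : MeasurableSpace Ω} (P : Measure Ω) (𝒢 : MeasurableSpace Ω)
    (u1 u2 : ℝ → ℝ) (α : ℝ) (X : Ω → ℝ) : Set (Ω → ℝ) :=
  {Z | BddMeas 𝒢 Z ∧ ∀ W, BddMeas 𝒢 W → piRisk P u1 u2 α X Z ≤ piRisk P u1 u2 α X W}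

/-- `ρ` is an essential infimum of the family `S` of random variables in the a.s. order. -/
def IsEssInf {mΩ : MeasurableSpace Ω} (P : Measure Ω) (S : Set (Ω → ℝ)) (ρ : Ω → ℝ) : Prop :=
  (∀ Z ∈ S, ρ ≤ᵐ[P] Z) ∧ ∀ W : Ω → ℝ, (∀ Z ∈ S, W ≤ᵐ[P] Z) → W ≤ᵐ[P] ρ

/-- The probability space is non-atomic. -/
def Nonatomic {mΩ : MeasurableSpace Ω} (P : Measure Ω) : Prop :=
  ∀ A : Set Ω, MeasurableSet[mΩ] A → 0 < P A →
    ∃ B ⊆ A, MeasurableSet[mΩ] B ∧ 0 < P B ∧ P B < P A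

/-- The acceptance set of the conditional shortfall risk measure:
`{Z ∈ L∞(𝒢) : E[v(X−Z)|𝒢] ≤ 0 a.s.}`. -/
def ShortfallSet {mΩ : MeasurableSpace Ω} (P : Measure Ω) (𝒢 : MeasurableSpace Ω)
    (v : ℝ → ℝ) (X : Ω → ℝ) : Set (Ω → ℝ) :=
  {Z | BddMeas 𝒢 Z ∧ ∀ᵐ ω ∂P, (P[fun ω' => v (X ω' - Z ω')|𝒢]) ω ≤ 0}

/-- Left derivative of `u` at `x`, multiplied by the indicator of `{x > 0}`. -/
noncomputable def ldInd (u : ℝ → ℝ) (x : ℝ) : ℝ :=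
  if 0 < x then derivWithin u (Set.Iic x) x else 0

/-- Right derivative of `u` at `x`, multiplied by the indicator of `{x ≥ 0}`. -/
noncomputable def rdInd (u : ℝ → ℝ) (x : ℝ) : ℝ :=
  if 0 ≤ x then derivWithin u (Set.Ici x) x else 0

/-- The function `v` built from `u1, u2, α`: `v(x) = α·(u1)'_−(x)` for `x > 0` and
`v(x) = −(1−α)·(u2)'_+(−x)` for `x ≤ 0`. -/
noncomputable def vFun (u1 u2 : ℝ → ℝ) (α : ℝ) (x : ℝ) : ℝ :=
  if 0 < x then α * derivWithin u1 (Set.Iic x) x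
  else -((1 - α) * derivWithin u2 (Set.Ici (-x)) (-x))

/-- `ρ` is a conditional convex risk measure: monotone, conditionally translation
invariant, conditionally convex and normalized. -/
def IsCondConvexRM {mΩ : MeasurableSpace Ω} (P : Measure Ω) (𝒢 : MeasurableSpace Ω)
    (ρ : (Ω → ℝ) → (Ω → ℝ)) : Prop :=
  (∀ X Y : Ω → ℝ, BddMeas mΩ X → BddMeas mΩ Y → X ≤ᵐ[P] Y → ρ X ≤ᵐ[P] ρ Y) ∧
  (∀ X Z : Ω → ℝ, BddMeas mΩ X → BddMeas 𝒢 Z →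
      ρ (fun ω => X ω + Z ω) =ᵐ[P] fun ω => ρ X ω + Z ω) ∧
  (∀ X Y Λ : Ω → ℝ, BddMeas mΩ X → BddMeas mΩ Y → BddMeas 𝒢 Λ →
      (∀ᵐ ω ∂P, 0 ≤ Λ ω ∧ Λ ω ≤ 1) →
      ρ (fun ω => Λ ω * X ω + (1 - Λ ω) * Y ω) ≤ᵐ[P]
        fun ω => Λ ω * ρ X ω + (1 - Λ ω) * ρ Y ω) ∧
  (ρ (fun _ => 0) =ᵐ[P] fun _ => 0)

/-- `ρ` is a conditional coherent risk measure: a conditional convex risk measure that is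
conditionally positively homogeneous. -/
def IsCondCoherentRM {mΩ : MeasurableSpace Ω} (P : Measure Ω) (𝒢 : MeasurableSpace Ω)
    (ρ : (Ω → ℝ) → (Ω → ℝ)) : Prop :=
  IsCondConvexRM P 𝒢 ρ ∧
  ∀ X Λ : Ω → ℝ, BddMeas mΩ X → BddMeas 𝒢 Λ → (∀ᵐ ω ∂P, 0 ≤ Λ ω) →
    ρ (fun ω => Λ ω * X ω) =ᵐ[P] fun ω => Λ ω * ρ X ω

/-- `𝒢` is generated by a finite measurable partition of `Ω`, each cell having positive
probability. -/
def FinitePartitionGen {mΩ : MeasurableSpace Ω} (P : Measure Ω)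
    (𝒢 : MeasurableSpace Ω) : Prop :=
  ∃ (n : ℕ) (A : Fin n → Set Ω),
    (∀ i, MeasurableSet[mΩ] (A i)) ∧ (∀ i, 0 < P (A i)) ∧
    Pairwise (Function.onFun Disjoint A) ∧ (⋃ i, A i) = Set.univ ∧
    𝒢 = MeasurableSpace.generateFrom {s | ∃ i, s = A i}

lemma Uicx.mono_pos {u : ℝ → ℝ} (h : Uicx u) : Monotone fun t : ℝ => u (max t 0) := by
  intro a b hab
  exact h.1.monotoneOn (Set.mem_Ici.2 (le_max_right _ _)) (Set.mem_Ici.2 (le_max_right _ _))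
    (max_le_max_right 0 hab)

lemma Uicx.integrable_pos {mΩ : MeasurableSpace Ω} (P : Measure Ω) [IsProbabilityMeasure P]
    {u : ℝ → ℝ} (h : Uicx u) {X Z : Ω → ℝ} (hX : BddMeas mΩ X) (hZ : BddMeas mΩ Z) :
    Integrable (fun ω => u (max (X ω - Z ω) 0)) P := by
  obtain ⟨hXm, C, hC⟩ := hX
  obtain ⟨hZm, D, hD⟩ := hZ
  have hm : Measurable fun ω => u (max (X ω - Z ω) 0) :=
    h.mono_pos.measurable.comp (hXm.sub hZm)
  refine Integrable.of_bound hm.aestronglyMeasurable (u (max (C + D) 0)) ?_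
  refine Filter.Eventually.of_forall fun ω => ?_
  have h0 : 0 ≤ u (max (X ω - Z ω) 0) := by
    have := h.1.monotoneOn (Set.mem_Ici.2 le_rfl)
      (Set.mem_Ici.2 (le_max_right (X ω - Z ω) 0)) (le_max_right _ _)
    rwa [h.2.2.1] at this
  rw [Real.norm_of_nonneg h0]
  apply h.mono_pos
  have a := abs_le.1 (hC ω)
  have b := abs_le.1 (hD ω)
  linarith

lemma BddMeas.min_max {m : MeasurableSpace Ω} {Z W : Ω → ℝ} (hZ : BddMeas m Z)
    (hW : BddMeas m W) :
    BddMeas m (fun ω => min (Z ω) (W ω)) ∧ BddMeas m (fun ω => max (Z ω) (W ω)) := by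
  obtain ⟨hZm, C, hC⟩ := hZ
  obtain ⟨hWm, D, hD⟩ := hW
  refine ⟨⟨hZm.min hWm, max C D, fun ω => ?_⟩, ⟨hZm.max hWm, max C D, fun ω => ?_⟩⟩
  · rcases min_choice (Z ω) (W ω) with e | e <;> beta_reduce <;> rw [e]
    · exact (hC ω).trans (le_max_left _ _)
    · exact (hD ω).trans (le_max_right _ _)
  · rcases max_choice (Z ω) (W ω) with e | e <;> beta_reduce <;> rw [e]
    · exact (hC ω).trans (le_max_left _ _)
    · exact (hD ω).trans (le_max_right _ _)

/-- Proposition 5.1 (i): the conditional generalized quantile is monotone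
in the confidence level `α`. -/
theorem conditional_generalized_quantile_mono_in_level
    [mΩ : MeasurableSpace Ω] (P : Measure Ω) [IsProbabilityMeasure P]
    (hP : Nonatomic P) (𝒢 : MeasurableSpace Ω) (hG : 𝒢 ≤ mΩ)
    {u1 u2 : ℝ → ℝ} (h1 : Uicx u1) (h2 : Uicx u2)
    (X : Ω → ℝ) (hX : BddMeas mΩ X)
    {α1 α2 : ℝ} (hα1 : 0 < α1) (h12 : α1 ≤ α2) (hα2 : α2 < 1)
    (ρ1 ρ2 : Ω → ℝ)
    (hρ1 : IsEssInf P (ArgminSet P 𝒢 u1 u2 α1 X) ρ1)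
    (hρ2 : IsEssInf P (ArgminSet P 𝒢 u1 u2 α2 X) ρ2) :
    ρ1 ≤ᵐ[P] ρ2 := by
  classical
  obtain ⟨Z1, hZ1⟩ : (ArgminSet P 𝒢 u1 u2 α1 X).Nonempty := by
    by_contra hne
    rw [Set.not_nonempty_iff_eq_empty] at hne
    have := hρ1.2 (fun ω => ρ1 ω + 1) (by simp [hne])
    obtain ⟨ω, hω⟩ := this.exists
    simp only at hω
    linarith
  refine hρ2.2 ρ1 fun Z2 hZ2 => ?_
  have up : ∀ {Z : Ω → ℝ}, BddMeas 𝒢 Z → BddMeas mΩ Z := fun h => ⟨h.1.mono hG le_rfl, h.2⟩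
  obtain ⟨hm, hM⟩ := hZ1.1.min_max hZ2.1
  suffices hmem : (fun ω => min (Z1 ω) (Z2 ω)) ∈ ArgminSet P 𝒢 u1 u2 α1 X by
    filter_upwards [hρ1.1 _ hmem] with ω hω
    exact hω.trans (min_le_right _ _)
  refine ⟨hm, fun W hW => le_trans ?_ (hZ1.2 W hW)⟩
  have key := hZ2.2 _ hM
  have i1 : ∀ {Z : Ω → ℝ}, BddMeas 𝒢 Z → Integrable (fun ω => u1 (max (X ω - Z ω) 0)) P :=
    fun h => h1.integrable_pos P hX (up h)
  have i2 : ∀ {Z : Ω → ℝ}, BddMeas 𝒢 Z → Integrable (fun ω => u2 (max (Z ω - X ω) 0)) P :=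
    fun h => h2.integrable_pos P (up h) hX
  have e1 : (∫ ω, u1 (max (X ω - min (Z1 ω) (Z2 ω)) 0) ∂P)
        + ∫ ω, u1 (max (X ω - max (Z1 ω) (Z2 ω)) 0) ∂P
      = (∫ ω, u1 (max (X ω - Z1 ω) 0) ∂P) + ∫ ω, u1 (max (X ω - Z2 ω) 0) ∂P := by
    rw [← integral_add (i1 hm) (i1 hM), ← integral_add (i1 hZ1.1) (i1 hZ2.1)]
    congr 1
    funext ω
    rcases le_total (Z1 ω) (Z2 ω) with h | h <;> simp [h, add_comm]
  have e2 : (∫ ω, u2 (max (min (Z1 ω) (Z2 ω) - X ω) 0) ∂P)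
        + ∫ ω, u2 (max (max (Z1 ω) (Z2 ω) - X ω) 0) ∂P
      = (∫ ω, u2 (max (Z1 ω - X ω) 0) ∂P) + ∫ ω, u2 (max (Z2 ω - X ω) 0) ∂P := by
    rw [← integral_add (i2 hm) (i2 hM), ← integral_add (i2 hZ1.1) (i2 hZ2.1)]
    congr 1
    funext ω
    rcases le_total (Z1 ω) (Z2 ω) with h | h <;> simp [h, add_comm]
  have d1 : (∫ ω, u1 (max (X ω - max (Z1 ω) (Z2 ω)) 0) ∂P)
      ≤ ∫ ω, u1 (max (X ω - Z2 ω) 0) ∂P :=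
    integral_mono (i1 hM) (i1 hZ2.1) fun ω =>
      h1.mono_pos (sub_le_sub_left (le_max_right _ _) _)
  have d2 : (∫ ω, u2 (max (Z2 ω - X ω) 0) ∂P)
      ≤ ∫ ω, u2 (max (max (Z1 ω) (Z2 ω) - X ω) 0) ∂P :=
    integral_mono (i2 hZ2.1) (i2 hM) fun ω =>
      h2.mono_pos (sub_le_sub_right (le_max_right _ _) _)
  unfold piRisk at key ⊢
  rw [eq_sub_of_add_eq e1, eq_sub_of_add_eq e2]
  nlinarith [mul_nonneg (sub_nonneg.2 h12) (sub_nonneg.2 d1),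
    mul_nonneg (sub_nonneg.2 h12) (sub_nonneg.2 d2)]
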